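/- Under the hypotheses that p > 1, p' = p/(p-1), c ∈ ℝ, h ∈ L^∞(0,1), and f ∈ L^1(0,1) with f > 0 lower semicontinuous on (0,1): if y_1 and y_2 are two absolutely continuous solutions of y'(t) = p'[(c - h(t))(max(y(t),0))^{1/p} - f(t)] a.e. on (0,1) with y_1(1) = y_2(1) = 0, then y_1 = y_2 on [0,1]. (Uniqueness of the backward initial value problem.) -/

import Mathlib

open MeasureTheory Set

theorem aux_basic (F y : ℝ → ℝ) (hF : IntegrableOn F (Set.Icc 0 1))
    (hy : ∀ t ∈ Set.Icc (0 : ℝ) 1, y t = -∫ τ in t..1, F τ) :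
    AbsolutelyContinuousOnInterval y 0 1 ∧
    (∀ᵐ x, x ∈ Set.Ioo (0:ℝ) 1 → HasDerivAt y (F x) x) ∧
    (∀ a ∈ Set.Icc (0:ℝ) 1, ∀ b ∈ Set.Icc (0:ℝ) 1, IntervalIntegrable F volume a b ∧
      y b - y a = ∫ τ in a..b, F τ) := by
  have hI : IntervalIntegrable F volume 0 1 :=
    (intervalIntegrable_iff_integrableOn_Icc_of_le zero_le_one).2 hF
  have h01 : uIcc (0:ℝ) 1 = Icc 0 1 := uIcc_of_le zero_le_one
  have heq : ∀ t ∈ Icc (0:ℝ) 1, y t = ∫ τ in (1:ℝ)..t, F τ := by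
    intro t ht
    rw [hy t ht, intervalIntegral.integral_symm 1 t]
    simp
  have hii : ∀ a ∈ Set.Icc (0:ℝ) 1, ∀ b ∈ Set.Icc (0:ℝ) 1, IntervalIntegrable F volume a b := by
    intro a ha b hb
    apply hI.mono_set
    rw [h01]
    exact uIcc_subset_Icc ha hb
  refine ⟨?_, ?_, ?_⟩
  · have h := hI.absolutelyContinuousOnInterval_intervalIntegral (c := 1) (by simp)
    rw [absolutelyContinuousOnInterval_iff] at h ⊢
    intro ε hε
    obtain ⟨δ, hδ, H⟩ := h ε hε
    refine ⟨δ, hδ, fun E hE hE2 => ?_⟩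
    have := H E hE hE2
    refine lt_of_eq_of_lt ?_ this
    apply Finset.sum_congr rfl
    intro i hi
    have h2 := hE.1 i hi
    rw [h01] at h2
    rw [heq _ h2.1, heq _ h2.2]
  · filter_upwards [hI.ae_hasDerivAt_integral] with x hx hx1
    have := hx (by rw [h01]; exact Ioo_subset_Icc_self hx1) 1 (by simp)
    apply this.congr_of_eventuallyEq
    filter_upwards [Ioo_mem_nhds hx1.1 hx1.2] with t ht
    exact heq t (Ioo_subset_Icc_self ht)
  · intro a ha b hb
    refine ⟨hii a ha b hb, ?_⟩
    rw [heq a ha, heq b hb]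
    have h1 : (1:ℝ) ∈ Icc (0:ℝ) 1 := by simp
    exact intervalIntegral.integral_interval_sub_left (hii 1 h1 b hb) (hii 1 h1 a ha)

theorem aux_comp (g y : ℝ → ℝ) (K : NNReal) (s : Set ℝ) (a b : ℝ)
    (hy : AbsolutelyContinuousOnInterval y a b)
    (hg : LipschitzOnWith K g s) (hm : ∀ t ∈ uIcc a b, y t ∈ s) :
    AbsolutelyContinuousOnInterval (fun t => g (y t)) a b := by
  rw [absolutelyContinuousOnInterval_iff] at hy ⊢
  intro ε hε
  obtain ⟨δ, hδ, H⟩ := hy (ε / (K + 1)) (by positivity)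
  refine ⟨δ, hδ, fun E hE hE2 => ?_⟩
  have h3 := H E hE hE2
  calc ∑ i ∈ Finset.range E.1, dist (g (y (E.2 i).1)) (g (y (E.2 i).2))
      ≤ ∑ i ∈ Finset.range E.1, ((K:ℝ) + 1) * dist (y (E.2 i).1) (y (E.2 i).2) := by
        apply Finset.sum_le_sum
        intro i hi
        have h2 := hE.1 i hi
        have := hg.dist_le_mul _ (hm _ h2.1) _ (hm _ h2.2)
        have hd : 0 ≤ dist (y (E.2 i).1) (y (E.2 i).2) := dist_nonneg
        nlinarith
    _ = ((K:ℝ) + 1) * ∑ i ∈ Finset.range E.1, dist (y (E.2 i).1) (y (E.2 i).2) := by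
        rw [Finset.mul_sum]
    _ < ((K:ℝ) + 1) * (ε / (K + 1)) := by gcongr
    _ = ε := by field_simp

theorem aux_nonneg (p p' c : ℝ) (hp : 1 < p) (hp' : p' = p / (p - 1))
    (h f y : ℝ → ℝ)
    (hfpos : ∀ t ∈ Set.Ioo (0 : ℝ) 1, 0 < f t)
    (hF : IntegrableOn
      (fun τ => p' * ((c - h τ) * (max (y τ) 0) ^ (1 / p) - f τ)) (Set.Icc 0 1))
    (hy1 : y 1 = 0)
    (hy : ∀ t ∈ Set.Icc (0 : ℝ) 1,
      y t = -∫ τ in t..1, p' * ((c - h τ) * (max (y τ) 0) ^ (1 / p) - f τ)) :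
    ∀ t ∈ Set.Icc (0 : ℝ) 1, 0 ≤ y t := by
  obtain ⟨hac, -, hint⟩ := aux_basic _ y hF hy
  have hc : ContinuousOn y (Icc 0 1) := by
    have := hac.continuousOn
    rwa [uIcc_of_le zero_le_one] at this
  have hp'0 : 0 < p' := by rw [hp']; apply div_pos <;> linarith
  intro t ht
  by_contra hneg
  push Not at hneg
  have hK : IsCompact {s ∈ Icc t 1 | 0 ≤ y s} := by
    apply isCompact_Icc.of_isClosed_subset _ (sep_subset _ _)
    exact isClosed_Icc.isClosed_le continuousOn_const (hc.mono (Icc_subset_Icc_left ht.1))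
  obtain ⟨s, ⟨hs, hys⟩, hmin⟩ := hK.exists_isLeast ⟨1, ⟨ht.2, le_rfl⟩, hy1.ge⟩
  have hs01 : s ∈ Icc (0:ℝ) 1 := ⟨ht.1.trans hs.1, hs.2⟩
  have h1 := (hint t ht s hs01).2
  have h2 : ∫ τ in t..s, p' * ((c - h τ) * (max (y τ) 0) ^ (1 / p) - f τ) ≤ ∫ τ in t..s, (0:ℝ) := by
    apply intervalIntegral.integral_mono_on_of_le_Ioo hs.1 (hint t ht s hs01).1 (by simp)
    intro x hx
    have hx01 : x ∈ Ioo (0:ℝ) 1 := ⟨ht.1.trans_lt hx.1, hx.2.trans_le hs.2⟩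
    have hyx : y x < 0 := by
      by_contra hh
      push Not at hh
      have := hmin ⟨⟨hx.1.le, hx01.2.le⟩, hh⟩
      linarith [hx.2]
    rw [max_eq_right hyx.le, Real.zero_rpow (by positivity)]
    have := mul_pos hp'0 (hfpos x hx01)
    linarith
  simp only [intervalIntegral.integral_zero] at h2
  linarith

theorem aux_pos (p p' c : ℝ) (hp : 1 < p) (hp' : p' = p / (p - 1))
    (h f y : ℝ → ℝ)
    (hhb : ∃ M, ∀ t ∈ Set.Ioo (0 : ℝ) 1, |h t| ≤ M)
    (hfpos : ∀ t ∈ Set.Ioo (0 : ℝ) 1, 0 < f t)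
    (hflsc : LowerSemicontinuousOn f (Set.Ioo 0 1))
    (hF : IntegrableOn
      (fun τ => p' * ((c - h τ) * (max (y τ) 0) ^ (1 / p) - f τ)) (Set.Icc 0 1))
    (hy1 : y 1 = 0)
    (hy : ∀ t ∈ Set.Icc (0 : ℝ) 1,
      y t = -∫ τ in t..1, p' * ((c - h τ) * (max (y τ) 0) ^ (1 / p) - f τ)) :
    ∀ t ∈ Set.Ioo (0 : ℝ) 1, 0 < y t := by
  have hnn := aux_nonneg p p' c hp hp' h f y hfpos hF hy1 hy
  obtain ⟨hac, -, hint⟩ := aux_basic _ y hF hy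
  have hc : ContinuousOn y (Icc 0 1) := by
    have := hac.continuousOn
    rwa [uIcc_of_le zero_le_one] at this
  have hp'0 : 0 < p' := by rw [hp']; apply div_pos <;> linarith
  obtain ⟨M, hM⟩ := hhb
  intro t ht
  by_contra hneg
  have hyt : y t = 0 := le_antisymm (not_lt.1 hneg) (hnn t (Ioo_subset_Icc_self ht))
  have hnhds : Icc (0:ℝ) 1 ∈ nhds t := Icc_mem_nhds ht.1 ht.2
  have hM0 : 0 ≤ M := (abs_nonneg _).trans (hM t ht)
  set C := |c| + M + 1 with hC
  have hC0 : 0 < C := by positivity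
  have hm : 0 < f t / 2 := half_pos (hfpos t ht)
  have e1 : ∀ᶠ x in nhds t, f t / 2 < f x := by
    have := hflsc t ht (f t / 2) (by linarith [hfpos t ht])
    rwa [isOpen_Ioo.nhdsWithin_eq ht] at this
  have e2 : ∀ᶠ x in nhds t, (max (y x) 0) ^ (1 / p) < f t / 4 / C := by
    have hca : ContinuousAt (fun x => (max (y x) 0) ^ (1 / p)) t := by
      apply ContinuousAt.rpow_const
      · exact (hc.continuousAt hnhds).max continuousAt_const
      · right; positivity
    apply hca.eventually_lt_const
    simp only [hyt, max_self]
    rw [Real.zero_rpow (by positivity)]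
    have := hfpos t ht
    positivity
  have e3 := e1.and (e2.and (Ioo_mem_nhds ht.1 ht.2))
  obtain ⟨ε, hε, hball⟩ := Metric.eventually_nhds_iff.1 e3
  have hb : ∀ x ∈ Icc t (t + ε/2), f t / 2 < f x ∧ (max (y x) 0) ^ (1 / p) < f t / 4 / C ∧
      x ∈ Ioo (0:ℝ) 1 := by
    intro x hx
    apply hball
    rw [Real.dist_eq, abs_lt]
    constructor <;> linarith [hx.1, hx.2]
  have hs01 : t + ε/2 ∈ Icc (0:ℝ) 1 :=
    Ioo_subset_Icc_self (hb (t + ε/2) ⟨by linarith, le_rfl⟩).2.2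
  have ht01 := Ioo_subset_Icc_self ht
  have h1 := (hint t ht01 _ hs01).2
  have h2 : ∫ τ in t..(t+ε/2), p' * ((c - h τ) * (max (y τ) 0) ^ (1 / p) - f τ)
      ≤ ∫ τ in t..(t+ε/2), (- (p' * (f t / 4))) := by
    apply intervalIntegral.integral_mono_on_of_le_Ioo (by linarith) (hint t ht01 _ hs01).1 (by simp)
    intro x hx
    obtain ⟨b1, b2, b3⟩ := hb x (Ioo_subset_Icc_self hx)
    have b4 : c - h x ≤ C := by
      have := abs_le.1 (hM x b3)
      have := le_abs_self c
      linarith [this]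
    have b5 : 0 ≤ (max (y x) 0) ^ (1 / p) := by positivity
    have b6 : (c - h x) * (max (y x) 0) ^ (1 / p) ≤ f t / 4 := by
      calc _ ≤ C * (max (y x) 0) ^ (1 / p) := by gcongr
        _ ≤ C * (f t / 4 / C) := by gcongr
        _ = f t / 4 := by field_simp
    rw [← mul_neg]
    apply mul_le_mul_of_nonneg_left _ hp'0.le
    linarith
  rw [intervalIntegral.integral_const, smul_eq_mul] at h2
  have := hnn _ hs01
  have : 0 < (t + ε/2 - t) * (p' * (f t / 4)) := by
    have := hfpos t ht
    apply mul_pos <;> [linarith; positivity]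
  linarith

theorem aux_deriv (p p' a b Y : ℝ) (hp : 1 < p) (hp' : p' = p / (p - 1)) (hY : 0 < Y) :
    (p' * (a * (max Y 0) ^ (1 / p) - b)) * (1 / p') * Y ^ (1 / p' - 1)
      = a - b * Y ^ (-(1 / p)) := by
  have hp0 : p ≠ 0 := by linarith
  have hp1 : p - 1 ≠ 0 := by linarith
  have hp'0 : p' ≠ 0 := by rw [hp']; positivity
  have e : 1 / p' - 1 = -(1 / p) := by rw [hp']; field_simp; ring
  rw [e, max_eq_left hY.le]
  have : Y ^ (1 / p) * Y ^ (-(1 / p)) = 1 := by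
    rw [← Real.rpow_add hY]; simp
  field_simp
  linear_combination a * this

theorem aux_le (p p' c : ℝ) (hp : 1 < p) (hp' : p' = p / (p - 1))
    (h f y₁ y₂ : ℝ → ℝ)
    (hhb : ∃ M, ∀ t ∈ Set.Ioo (0 : ℝ) 1, |h t| ≤ M)
    (hfpos : ∀ t ∈ Set.Ioo (0 : ℝ) 1, 0 < f t)
    (hflsc : LowerSemicontinuousOn f (Set.Ioo 0 1))
    (hF₁int : IntegrableOn
      (fun τ => p' * ((c - h τ) * (max (y₁ τ) 0) ^ (1 / p) - f τ)) (Set.Icc 0 1))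
    (hF₂int : IntegrableOn
      (fun τ => p' * ((c - h τ) * (max (y₂ τ) 0) ^ (1 / p) - f τ)) (Set.Icc 0 1))
    (hy₁1 : y₁ 1 = 0) (hy₂1 : y₂ 1 = 0)
    (hy₁sol : ∀ t ∈ Set.Icc (0 : ℝ) 1,
      y₁ t = -∫ τ in t..1, p' * ((c - h τ) * (max (y₁ τ) 0) ^ (1 / p) - f τ))
    (hy₂sol : ∀ t ∈ Set.Icc (0 : ℝ) 1,
      y₂ t = -∫ τ in t..1, p' * ((c - h τ) * (max (y₂ τ) 0) ^ (1 / p) - f τ)) :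
    ∀ t ∈ Set.Icc (0 : ℝ) 1, y₁ t ≤ y₂ t := by
  have hn1 := aux_nonneg p p' c hp hp' h f y₁ hfpos hF₁int hy₁1 hy₁sol
  have hP1 := aux_pos p p' c hp hp' h f y₁ hhb hfpos hflsc hF₁int hy₁1 hy₁sol
  have hP2 := aux_pos p p' c hp hp' h f y₂ hhb hfpos hflsc hF₂int hy₂1 hy₂sol
  have hn2 := aux_nonneg p p' c hp hp' h f y₂ hfpos hF₂int hy₂1 hy₂sol
  obtain ⟨hac1, hd1, -⟩ := aux_basic _ y₁ hF₁int hy₁sol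
  obtain ⟨hac2, hd2, -⟩ := aux_basic _ y₂ hF₂int hy₂sol
  have hc1 : ContinuousOn y₁ (Icc 0 1) := by
    have := hac1.continuousOn
    rwa [uIcc_of_le zero_le_one] at this
  have hc2 : ContinuousOn y₂ (Icc 0 1) := by
    have := hac2.continuousOn
    rwa [uIcc_of_le zero_le_one] at this
  have hp'0 : 0 < p' := by rw [hp']; apply div_pos <;> linarith
  have hq : 0 < 1 / p' := by positivity
  have hcl : closure (Ioo (0:ℝ) 1) = Icc 0 1 := closure_Ioo (by norm_num)
  have key : ∀ t ∈ Ioo (0:ℝ) 1, y₁ t ≤ y₂ t := by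
    intro t ht
    by_contra hneg
    push Not at hneg
    have hK : IsCompact {s ∈ Icc t 1 | y₁ s ≤ y₂ s} := by
      apply isCompact_Icc.of_isClosed_subset _ (sep_subset _ _)
      exact isClosed_Icc.isClosed_le (hc1.mono (Icc_subset_Icc_left ht.1.le))
        (hc2.mono (Icc_subset_Icc_left ht.1.le))
    obtain ⟨s, ⟨hs, hys⟩, hmin⟩ := hK.exists_isLeast ⟨1, ⟨ht.2.le, le_rfl⟩, by rw [hy₁1, hy₂1]⟩
    have hs01 : s ∈ Icc (0:ℝ) 1 := ⟨ht.1.le.trans hs.1, hs.2⟩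
    have hts : t < s := by
      rcases hs.1.eq_or_lt with e | e
      · subst e; linarith
      · exact e
    have hgt : ∀ x, t ≤ x → x < s → y₂ x < y₁ x := by
      intro x h1 h2
      by_contra hh
      push Not at hh
      have := hmin ⟨⟨h1, h2.le.trans hs.2⟩, hh⟩
      linarith
    have acz : ∀ (y : ℝ → ℝ), AbsolutelyContinuousOnInterval y 0 1 → ContinuousOn y (Icc 0 1) →
        (∀ x ∈ Ioo (0:ℝ) 1, 0 < y x) → ∀ b ∈ Ioo t s,
        AbsolutelyContinuousOnInterval (fun x => y x ^ (1 / p')) t b := by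
      intro y hac hc hpos b hb
      have hsub : Icc t b ⊆ Icc 0 1 := Icc_subset_Icc ht.1.le (hb.2.le.trans hs.2)
      have hb1 : b < 1 := hb.2.trans_le hs.2
      obtain ⟨x₀, hx₀, hmn⟩ := isCompact_Icc.exists_isMinOn (nonempty_Icc.2 hb.1.le) (hc.mono hsub)
      obtain ⟨x₁, hx₁, hmx⟩ := isCompact_Icc.exists_isMaxOn (nonempty_Icc.2 hb.1.le) (hc.mono hsub)
      have hx₀pos := hpos x₀ ⟨ht.1.trans_le hx₀.1, hx₀.2.trans_lt hb1⟩
      have hcd : ContDiffOn ℝ 1 (fun u : ℝ => u ^ (1 / p')) (Icc (y x₀) (y x₁)) := by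
        intro u hu
        exact (Real.contDiffAt_rpow_const_of_ne (hx₀pos.trans_le hu.1).ne').contDiffWithinAt
      obtain ⟨K, hKL⟩ := hcd.exists_lipschitzOnWith (by decide) (convex_Icc _ _) isCompact_Icc
      refine aux_comp (fun u => u ^ (1 / p')) y K _ t b (hac.mono ?_) hKL ?_
      · rw [uIcc_of_le hb.1.le, uIcc_of_le zero_le_one]; exact hsub
      · rw [uIcc_of_le hb.1.le]
        intro x hx
        exact ⟨hmn hx, hmx hx⟩
    set w : ℝ → ℝ := fun x => y₁ x ^ (1 / p') - y₂ x ^ (1 / p') with hw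
    have hwc : ContinuousOn w (Icc 0 1) :=
      (hc1.rpow_const (fun _ _ => Or.inr hq.le)).sub (hc2.rpow_const (fun _ _ => Or.inr hq.le))
    have hmono : ∀ b ∈ Ioo t s, w t ≤ w b := by
      intro b hb
      have hac : AbsolutelyContinuousOnInterval w t b :=
        (acz y₁ hac1 hc1 hP1 b hb).sub (acz y₂ hac2 hc2 hP2 b hb)
      have h1 := hac.integral_deriv_eq_sub
      have h2 : 0 ≤ ∫ x in t..b, deriv w x := by
        apply intervalIntegral.integral_nonneg_of_ae_restrict hb.1.le
        rw [Filter.EventuallyLE, ae_restrict_iff' measurableSet_Icc]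
        filter_upwards [hd1, hd2] with x hx1 hx2 hx
        have hxI : x ∈ Ioo (0:ℝ) 1 := ⟨ht.1.trans_le hx.1, (hx.2.trans_lt hb.2).trans_le hs.2⟩
        have p1 := hP1 x hxI
        have p2 := hP2 x hxI
        have d1 := (hx1 hxI).rpow_const (p := 1 / p') (Or.inl p1.ne')
        have d2 := (hx2 hxI).rpow_const (p := 1 / p') (Or.inl p2.ne')
        have d := (d1.sub d2).deriv
        rw [aux_deriv p p' _ _ _ hp hp' p1, aux_deriv p p' _ _ _ hp hp' p2] at d
        have d' : deriv w x = c - h x - f x * y₁ x ^ (-(1 / p))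
          - (c - h x - f x * y₂ x ^ (-(1 / p))) := d
        rw [d']
        have hle : y₁ x ^ (-(1 / p)) ≤ y₂ x ^ (-(1 / p)) := by
          apply Real.rpow_le_rpow_of_nonpos p2 (hgt x hx.1 (hx.2.trans_lt hb.2)).le
          have : 0 < 1 / p := by positivity
          linarith
        have := mul_le_mul_of_nonneg_left hle (hfpos x hxI).le
        simp only [Pi.zero_apply]
        linarith
      linarith
    have hws : w t ≤ w s := by
      have hcl2 : closure (Ioo t s) = Icc t s := closure_Ioo hts.ne
      refine le_on_closure (f := fun _ => w t) hmono continuousOn_const ?_ ?_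
      · rw [hcl2]; exact hwc.mono (Icc_subset_Icc ht.1.le hs.2)
      · rw [hcl2]; exact ⟨hts.le, le_rfl⟩
    have a1 : w s ≤ 0 := sub_nonpos.2 (Real.rpow_le_rpow (hn1 s hs01) hys hq.le)
    have a2 : 0 < w t := sub_pos.2 (Real.rpow_lt_rpow (hP2 t ht).le hneg hq)
    linarith
  intro t ht
  rw [← hcl] at ht hc1 hc2
  exact le_on_closure key hc1 hc2 ht

/-- Uniqueness for the backward initial value problem
`y' = p'[(c - h)(y⁺)^{1/p} - f]`, `y(1) = 0`: any two Carathéodory (absolutely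
continuous) solutions coincide on `[0,1]`.  Solutions are encoded through the
equivalent integral formulation. -/
theorem stmt5 (p p' c : ℝ) (hp : 1 < p) (hp' : p' = p / (p - 1))
    (h f y₁ y₂ : ℝ → ℝ)
    (hhm : Measurable h) (hhb : ∃ M, ∀ t ∈ Set.Ioo (0 : ℝ) 1, |h t| ≤ M)
    (hfint : IntegrableOn f (Set.Ioo 0 1))
    (hfpos : ∀ t ∈ Set.Ioo (0 : ℝ) 1, 0 < f t)
    (hflsc : LowerSemicontinuousOn f (Set.Ioo 0 1))
    (hF₁int : IntegrableOn
      (fun τ => p' * ((c - h τ) * (max (y₁ τ) 0) ^ (1 / p) - f τ)) (Set.Icc 0 1))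
    (hF₂int : IntegrableOn
      (fun τ => p' * ((c - h τ) * (max (y₂ τ) 0) ^ (1 / p) - f τ)) (Set.Icc 0 1))
    (hy₁1 : y₁ 1 = 0) (hy₂1 : y₂ 1 = 0)
    (hy₁sol : ∀ t ∈ Set.Icc (0 : ℝ) 1,
      y₁ t = -∫ τ in t..1, p' * ((c - h τ) * (max (y₁ τ) 0) ^ (1 / p) - f τ))
    (hy₂sol : ∀ t ∈ Set.Icc (0 : ℝ) 1,
      y₂ t = -∫ τ in t..1, p' * ((c - h τ) * (max (y₂ τ) 0) ^ (1 / p) - f τ)) :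
    ∀ t ∈ Set.Icc (0 : ℝ) 1, y₁ t = y₂ t := by
  intro t ht
  exact le_antisymm
    (aux_le p p' c hp hp' h f y₁ y₂ hhb hfpos hflsc hF₁int hF₂int hy₁1 hy₂1 hy₁sol hy₂sol t ht)
    (aux_le p p' c hp hp' h f y₂ y₁ hhb hfpos hflsc hF₂int hF₁int hy₂1 hy₁1 hy₂sol hy₁sol t ht)
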